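/- Let 0 < C_ω < 1 and let ω : 𝔻 → (0,∞) be a C¹ weight satisfying (1−|z|²)|∇ω(z)| ≤ C_ω ω(z) for all z ∈ 𝔻. Let f : 𝔻 → ℂ be holomorphic and injective (univalent) and suppose that |f′(z)|(1−|z|²)ω(z) → 0 as |z| → 1⁻. Then ω(a)² ∫_𝔻 |f′(z)|² (1 − |φ_a(z)|²) dm(z) → 0 as |a| → 1⁻. -/

import Mathlib

open Complex MeasureTheory Set Filter

noncomputable section

/-- The open unit disc in the complex plane. -/
def unitDisc : Set ℂ := Metric.ball 0 1

/-- The Möbius involution `φ_a(z) = (a - z)/(1 - conj(a) z)`. -/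
def mobius (a z : ℂ) : ℂ := (a - z) / (1 - (starRingEnd ℂ) a * z)

/-- The hyperbolic distance on the unit disc. -/
def hypDist (a z : ℂ) : ℝ :=
  (1 / 2) * Real.log ((1 + ‖mobius a z‖) / (1 - ‖mobius a z‖))

/-- The `BMOA` Garsia-type seminorm squared at the point `a`, with normalized
area measure `dm = dx dy / π`. -/
def bmoaSemi (f : ℂ → ℂ) (a : ℂ) : ℝ :=
  (Real.pi)⁻¹ * ∫ z in unitDisc, ‖deriv f z‖ ^ 2 * (1 - ‖mobius a z‖ ^ 2)

/-- `f` is an analytic function of bounded mean oscillation. -/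
def IsBMOA (f : ℂ → ℂ) : Prop :=
  DifferentiableOn ℂ f unitDisc ∧ ∃ C : ℝ, ∀ a ∈ unitDisc, bmoaSemi f a ≤ C

/-- `f` is an analytic function of vanishing mean oscillation. -/
def IsVMOA (f : ℂ → ℂ) : Prop :=
  IsBMOA f ∧ ∀ ε > 0, ∃ r < 1, ∀ a ∈ unitDisc, r < ‖a‖ → bmoaSemi f a < ε

/-- The Bloch quantity `|f'(z)| (1 - |z|²)`. -/
def blochSemi (f : ℂ → ℂ) (z : ℂ) : ℝ := ‖deriv f z‖ * (1 - ‖z‖ ^ 2)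

/-- `f` belongs to the Bloch space. -/
def IsBloch (f : ℂ → ℂ) : Prop :=
  DifferentiableOn ℂ f unitDisc ∧ ∃ C : ℝ, ∀ z ∈ unitDisc, blochSemi f z ≤ C

/-- `f` belongs to the little Bloch space. -/
def IsLittleBloch (f : ℂ → ℂ) : Prop :=
  IsBloch f ∧ ∀ ε > 0, ∃ r < 1, ∀ z ∈ unitDisc, r < ‖z‖ → blochSemi f z < ε

/-- The `BMOA` norm `|f(0)| + ‖f‖_*`. -/
def bmoaNorm (f : ℂ → ℂ) : ℝ :=
  ‖f 0‖ + Real.sqrt (⨆ a : unitDisc, bmoaSemi f (a : ℂ))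

/-- The Bloch norm `|f(0)| + sup_z |f'(z)|(1-|z|²)`. -/
def blochNorm (f : ℂ → ℂ) : ℝ :=
  ‖f 0‖ + ⨆ z : unitDisc, blochSemi f (z : ℂ)

/-- `φ` is a semigroup of holomorphic self-maps of the unit disc. -/
def IsHoloSemigroup (φ : ℝ → ℂ → ℂ) : Prop :=
  (∀ t : ℝ, 0 ≤ t → DifferentiableOn ℂ (φ t) unitDisc ∧ MapsTo (φ t) unitDisc unitDisc) ∧
  (∀ z ∈ unitDisc, φ 0 z = z) ∧
  (∀ t : ℝ, 0 ≤ t → ∀ s : ℝ, 0 ≤ s → ∀ z ∈ unitDisc, φ (t + s) z = φ t (φ s z)) ∧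
  (∀ K ⊆ unitDisc, IsCompact K →
    TendstoUniformlyOn (fun t z => φ t z) id (nhdsWithin 0 (Ioi 0)) K)

/-- The maximal subspace of strong continuity `[φ_t, BMOA]`. -/
def maxSubspaceBMOA (φ : ℝ → ℂ → ℂ) : Set (ℂ → ℂ) :=
  {f | IsBMOA f ∧
    Tendsto (fun t => bmoaNorm (fun z => f (φ t z) - f z)) (nhdsWithin 0 (Ioi 0)) (nhds 0)}

/-- The maximal subspace of strong continuity `[φ_t, 𝓑]`. -/
def maxSubspaceBloch (φ : ℝ → ℂ → ℂ) : Set (ℂ → ℂ) :=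
  {f | IsBloch f ∧
    Tendsto (fun t => blochNorm (fun z => f (φ t z) - f z)) (nhdsWithin 0 (Ioi 0)) (nhds 0)}

/-- `G` is the infinitesimal generator of the semigroup `φ`. -/
def IsGenerator (φ : ℝ → ℂ → ℂ) (G : ℂ → ℂ) : Prop :=
  DifferentiableOn ℂ G unitDisc ∧
  ∀ z ∈ unitDisc,
    Tendsto (fun t : ℝ => (φ t z - z) / (t : ℂ)) (nhdsWithin 0 (Ioi 0)) (nhds (G z))

/-- The semigroup is elliptic: its Denjoy–Wolff point lies in the disc. -/
def IsElliptic (φ : ℝ → ℂ → ℂ) : Prop :=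
  ∃ τ ∈ unitDisc, ∀ t : ℝ, 0 ≤ t → φ t τ = τ

/-- The logarithmic vanishing Bloch condition (LVB) on a generator `G`. -/
def LVB (G : ℂ → ℂ) : Prop :=
  ∀ ε > 0, ∃ r < 1, ∀ z ∈ unitDisc, r < ‖z‖ →
    (1 - ‖z‖ ^ 2) / ‖G z‖ * Real.log (1 / (1 - ‖z‖ ^ 2)) < ε

/-- The logarithmic vanishing mean oscillation condition (LVMO) on a generator `G`. -/
def LVMO (G : ℂ → ℂ) : Prop :=
  ∀ ε > 0, ∃ r < 1, ∀ a ∈ unitDisc, r < ‖a‖ →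
    (Real.log (Real.exp 1 / (1 - ‖a‖ ^ 2))) ^ 2 *
      ((Real.pi)⁻¹ * ∫ z in unitDisc, (1 - ‖mobius a z‖ ^ 2) / ‖G z‖ ^ 2) < ε

/-- `f` belongs to the logarithmic little Bloch space `𝓑_{log,0}`. -/
def InBlochLog0 (f : ℂ → ℂ) : Prop :=
  ∀ ε > 0, ∃ r < 1, ∀ z ∈ unitDisc, r < ‖z‖ →
    ‖deriv f z‖ * (1 - ‖z‖ ^ 2) * Real.log (Real.exp 1 / (1 - ‖z‖ ^ 2)) < ε

/-- `f` belongs to `VMOA_log`. -/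
def InVMOAlog (f : ℂ → ℂ) : Prop :=
  ∀ ε > 0, ∃ r < 1, ∀ a ∈ unitDisc, r < ‖a‖ →
    (Real.log (Real.exp 1 / (1 - ‖a‖ ^ 2))) ^ 2 * bmoaSemi f a < ε

/-- Hyperbolic midpoint of the segment `[0, w]`. -/
def wstar (w : ℂ) : ℂ :=
  (((1 - Real.sqrt (1 - ‖w‖ ^ 2)) / ‖w‖ ^ 2 : ℝ) : ℂ) * w

/-- The building-block function `β_w(z) = Log(e / (1 + conj(w) φ_{w*}(z)))`. -/
def betaB (w z : ℂ) : ℂ :=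
  Complex.log ((Real.exp 1 : ℂ) / (1 + (starRingEnd ℂ) w * mobius (wstar w) z))

/-- The (invariant) Carleson box `S(I_u)` associated with a point `u ∈ 𝔻 \ {0}`. -/
def carlesonBox (u : ℂ) : Set ℂ :=
  {z ∈ unitDisc | ((starRingEnd ℂ) u * mobius u z).re ≤ 0}

/-- The generalized Volterra operator `T_g f(z) = ∫₀^z f(ζ) g'(ζ) dζ`. -/
def volterra (g f : ℂ → ℂ) (z : ℂ) : ℂ :=
  z * ∫ t in (0:ℝ)..1, f ((t : ℂ) * z) * deriv g ((t : ℂ) * z)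

lemma mem_unitDisc {z : ℂ} : z ∈ unitDisc ↔ ‖z‖ < 1 := by simp [unitDisc]

lemma isOpen_unitDisc : IsOpen unitDisc := Metric.isOpen_ball

lemma one_sub_conj_mul_ne_zero {a w : ℂ} (ha : ‖a‖ < 1) (hw : ‖w‖ < 1) :
    1 - (starRingEnd ℂ) a * w ≠ 0 := by
  intro h
  have h1 : ‖(starRingEnd ℂ) a * w‖ = 1 := by rw [← sub_eq_zero.mp h]; simp
  rw [norm_mul, RCLike.norm_conj] at h1
  nlinarith [norm_nonneg a, norm_nonneg w]

lemma one_sub_norm_mobius_sq {a w : ℂ} (ha : ‖a‖ < 1) (hw : ‖w‖ < 1) :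
    1 - ‖mobius a w‖ ^ 2 =
      (1 - ‖a‖ ^ 2) * (1 - ‖w‖ ^ 2) / ‖1 - (starRingEnd ℂ) a * w‖ ^ 2 := by
  have h0 := one_sub_conj_mul_ne_zero ha hw
  have h1 : ‖1 - (starRingEnd ℂ) a * w‖ ^ 2 ≠ 0 := by positivity
  rw [mobius, norm_div, div_pow, eq_div_iff h1, sub_mul, div_mul_cancel₀ _ h1]
  simp only [← Complex.normSq_eq_norm_sq, Complex.normSq_apply]
  simp
  ring

lemma norm_mobius_lt_one {a w : ℂ} (ha : ‖a‖ < 1) (hw : ‖w‖ < 1) : ‖mobius a w‖ < 1 := by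
  have h0 := one_sub_conj_mul_ne_zero ha hw
  have h1 : 0 < 1 - ‖mobius a w‖ ^ 2 := by
    rw [one_sub_norm_mobius_sq ha hw]
    have h2 : 0 < 1 - ‖a‖ ^ 2 := by nlinarith [norm_nonneg a]
    have h3 : 0 < 1 - ‖w‖ ^ 2 := by nlinarith [norm_nonneg w]
    positivity
  nlinarith [norm_nonneg (mobius a w)]

lemma mobius_mobius {a w : ℂ} (ha : ‖a‖ < 1) (hw : ‖w‖ < 1) : mobius a (mobius a w) = w := by
  have h0 := one_sub_conj_mul_ne_zero ha hw
  have h1 := one_sub_conj_mul_ne_zero ha (norm_mobius_lt_one ha hw)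
  have h2 : 1 - (starRingEnd ℂ) a * a ≠ 0 := one_sub_conj_mul_ne_zero ha ha
  rw [mobius, div_eq_iff h1, mobius]
  rw [mul_comm] at h0
  field_simp
  ring

lemma mobius_zero (a : ℂ) : mobius a 0 = a := by simp [mobius]

lemma hasDerivAt_mobius {a w : ℂ} (ha : ‖a‖ < 1) (hw : ‖w‖ < 1) :
    HasDerivAt (mobius a)
      (-(1 - (starRingEnd ℂ) a * a) / (1 - (starRingEnd ℂ) a * w) ^ 2) w := by
  have h0 := one_sub_conj_mul_ne_zero ha hw
  have h1 : HasDerivAt (fun z : ℂ => a - z) (-1) w := by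
    simpa using (hasDerivAt_id w).const_sub a
  have h2 : HasDerivAt (fun z : ℂ => 1 - (starRingEnd ℂ) a * z) (-((starRingEnd ℂ) a)) w := by
    simpa using ((hasDerivAt_id w).const_mul ((starRingEnd ℂ) a)).const_sub 1
  refine (h1.fun_div h2 h0).congr_deriv ?_
  ring

lemma norm_deriv_mobius {a w : ℂ} (ha : ‖a‖ < 1) (hw : ‖w‖ < 1) :
    ‖-(1 - (starRingEnd ℂ) a * a) / (1 - (starRingEnd ℂ) a * w) ^ 2‖ =
      (1 - ‖mobius a w‖ ^ 2) / (1 - ‖w‖ ^ 2) := by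
  have h0 := one_sub_conj_mul_ne_zero ha hw
  have h1 : ‖1 - (starRingEnd ℂ) a * w‖ ≠ 0 := by positivity
  have h2 : 0 < 1 - ‖a‖ ^ 2 := by nlinarith [norm_nonneg a]
  have h3 : 1 - ‖w‖ ^ 2 ≠ 0 := by nlinarith [norm_nonneg w]
  have h4 : 1 - (starRingEnd ℂ) a * a = ((1 - ‖a‖ ^ 2 : ℝ) : ℂ) := by
    rw [mul_comm, Complex.mul_conj, Complex.normSq_eq_norm_sq]; push_cast; ring
  rw [one_sub_norm_mobius_sq ha hw, h4, norm_div, norm_neg, Complex.norm_real,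
    Real.norm_of_nonneg h2.le, norm_pow]
  field_simp

/-- `exp (C d)`, where `d` is the hyperbolic distance from `0` to `s`. -/
def hypExp (C s : ℝ) : ℝ := Real.exp (C / 2 * (Real.log (1 + s) - Real.log (1 - s)))

lemma hypExp_pos (C s : ℝ) : 0 < hypExp C s := Real.exp_pos _

lemma hypExp_zero (C : ℝ) : hypExp C 0 = 1 := by simp [hypExp]

lemma hasDerivAt_hypExp (C : ℝ) {s : ℝ} (h0 : 0 ≤ s) (h1 : s < 1) :
    HasDerivAt (hypExp C) (hypExp C s * (C / (1 - s ^ 2))) s := by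
  have hp : 1 + s ≠ 0 := by linarith
  have hm : 1 - s ≠ 0 := by linarith
  have hs : 1 - s ^ 2 ≠ 0 := by nlinarith
  have e1 : HasDerivAt (fun x : ℝ => Real.log (1 + x)) (1 / (1 + s)) s :=
    ((hasDerivAt_id s).const_add 1).log hp
  have e2 : HasDerivAt (fun x : ℝ => Real.log (1 - x)) (-1 / (1 - s)) s :=
    ((hasDerivAt_id s).const_sub 1).log hm
  have e3 : C / 2 * (1 / (1 + s) - -1 / (1 - s)) = C / (1 - s ^ 2) := by
    field_simp
    ring
  exact e3 ▸ ((e1.fun_sub e2).const_mul (C / 2)).exp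

lemma hypExp_le {C s t : ℝ} (hC0 : 0 < C) (hC1 : C < 1) (hs : 0 ≤ s) (ht : 0 < t)
    (hst : s ^ 2 < 1 - t) : hypExp C s ≤ 2 * t ^ (-C / 2) := by
  have hs1 : s < 1 := by nlinarith
  have l1 : Real.log (1 + s) ≤ Real.log 2 := Real.log_le_log (by linarith) (by linarith)
  have l2 : Real.log (t / 2) ≤ Real.log (1 - s) :=
    Real.log_le_log (by positivity) (by nlinarith)
  rw [Real.log_div ht.ne' two_ne_zero] at l2
  have l3 : 0 < Real.log 2 := Real.log_pos one_lt_two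
  rw [Real.rpow_def_of_pos ht, ← Real.exp_log (zero_lt_two' ℝ), ← Real.exp_add, hypExp,
    Real.exp_log zero_lt_two]
  apply Real.exp_le_exp.mpr
  nlinarith

section Path

variable {a w : ℂ}

lemma norm_ofReal_mul_lt_one (hw : ‖w‖ < 1) {t : ℝ} (ht : t ∈ Icc (0 : ℝ) 1) :
    ‖(t : ℂ) * w‖ < 1 := by
  rw [norm_mul, Complex.norm_real, Real.norm_of_nonneg ht.1]
  nlinarith [norm_nonneg w, ht.1, ht.2]

/-- The hyperbolic geodesic `t ↦ φ_a(t w)` and its speed. -/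
lemma exists_hasDerivAt_mobius_path (ha : ‖a‖ < 1) (hw : ‖w‖ < 1) {t : ℝ}
    (ht : t ∈ Icc (0 : ℝ) 1) :
    ∃ v : ℂ, HasDerivAt (fun s : ℝ => mobius a (s * w)) v t ∧
      ‖v‖ = ‖w‖ * (1 - ‖mobius a (t * w)‖ ^ 2) / (1 - (t * ‖w‖) ^ 2) := by
  have htw := norm_ofReal_mul_lt_one hw ht
  have h1 : HasDerivAt (fun s : ℝ => (s : ℂ) * w) w t := by
    simpa using (Complex.ofRealCLM.hasDerivAt (x := t)).mul_const w
  refine ⟨_, HasDerivAt.comp (h₂ := mobius a) t (hasDerivAt_mobius ha htw) h1, ?_⟩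
  rw [norm_mul, norm_deriv_mobius ha htw, norm_mul, Complex.norm_real, Real.norm_of_nonneg ht.1]
  ring

lemma hasDerivAt_hypExp_mul (C : ℝ) (hw : ‖w‖ < 1) {t : ℝ} (ht : t ∈ Icc (0 : ℝ) 1) :
    HasDerivAt (fun s : ℝ => hypExp C (s * ‖w‖))
      (hypExp C (t * ‖w‖) * (C / (1 - (t * ‖w‖) ^ 2)) * ‖w‖) t := by
  have h1 : HasDerivAt (fun s : ℝ => s * ‖w‖) ‖w‖ t := by
    simpa using (hasDerivAt_id t).mul_const ‖w‖
  exact HasDerivAt.comp (h₂ := hypExp C) t (hasDerivAt_hypExp C (mul_nonneg ht.1 (norm_nonneg w))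
    (by nlinarith [norm_nonneg w, ht.1, ht.2])) h1

/-- A regular weight varies at most exponentially in the hyperbolic distance. -/
lemma regular_weight_le {C : ℝ} {ω : ℂ → ℝ}
    (hω : DifferentiableOn ℝ ω unitDisc)
    (hreg : ∀ z ∈ unitDisc, (1 - ‖z‖ ^ 2) * ‖fderivWithin ℝ ω unitDisc z‖ ≤ C * ω z)
    (ha : ‖a‖ < 1) (hw : ‖w‖ < 1) {t : ℝ} (ht : t ∈ Icc (0 : ℝ) 1) :
    ω a ≤ ω (mobius a (t * w)) * hypExp C (t * ‖w‖) := by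
  set γ : ℝ → ℂ := fun s => mobius a (s * w) with hγ
  have key : ∀ s ∈ Icc (0 : ℝ) 1, ∃ d : ℝ,
      HasDerivAt (fun s : ℝ => ω (γ s) * hypExp C (s * ‖w‖)) d s ∧ 0 ≤ d := by
    intro s hs
    obtain ⟨v, hv, hvn⟩ := exists_hasDerivAt_mobius_path ha hw hs
    have hγs : ‖γ s‖ < 1 := norm_mobius_lt_one ha (norm_ofReal_mul_lt_one hw hs)
    have hmem : γ s ∈ unitDisc := mem_unitDisc.mpr hγs
    have hωs : HasFDerivAt ω (fderivWithin ℝ ω unitDisc (γ s)) (γ s) :=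
      (hω _ hmem).hasFDerivWithinAt.hasFDerivAt (isOpen_unitDisc.mem_nhds hmem)
    have hcomp : HasDerivAt (fun s : ℝ => ω (γ s)) (fderivWithin ℝ ω unitDisc (γ s) v) s :=
      hωs.comp_hasDerivAt s hv
    refine ⟨_, hcomp.fun_mul (hasDerivAt_hypExp_mul C hw hs), ?_⟩
    have hsw : 0 < 1 - (s * ‖w‖) ^ 2 := by
      have : s * ‖w‖ < 1 := by nlinarith [norm_nonneg w, hs.1, hs.2]
      nlinarith [mul_nonneg hs.1 (norm_nonneg w)]
    have hle : |fderivWithin ℝ ω unitDisc (γ s) v| ≤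
        C * ω (γ s) * (‖w‖ / (1 - (s * ‖w‖) ^ 2)) := by
      calc |fderivWithin ℝ ω unitDisc (γ s) v|
          ≤ ‖fderivWithin ℝ ω unitDisc (γ s)‖ * ‖v‖ :=
            (fderivWithin ℝ ω unitDisc (γ s)).le_opNorm v
        _ = ((1 - ‖γ s‖ ^ 2) * ‖fderivWithin ℝ ω unitDisc (γ s)‖) *
              (‖w‖ / (1 - (s * ‖w‖) ^ 2)) := by rw [hvn]; ring
        _ ≤ _ := mul_le_mul_of_nonneg_right (hreg _ hmem) (by positivity)
    have h1 := neg_le_of_abs_le hle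
    have hE := hypExp_pos C (s * ‖w‖)
    calc (0 : ℝ) ≤ (fderivWithin ℝ ω unitDisc (γ s) v +
          C * ω (γ s) * (‖w‖ / (1 - (s * ‖w‖) ^ 2))) * hypExp C (s * ‖w‖) :=
          mul_nonneg (by linarith) hE.le
      _ = _ := by ring
  have hmono : MonotoneOn (fun s : ℝ => ω (γ s) * hypExp C (s * ‖w‖)) (Icc 0 1) := by
    apply monotoneOn_of_deriv_nonneg (convex_Icc 0 1)
    · intro s hs
      obtain ⟨d, hd, -⟩ := key s hs
      exact hd.continuousAt.continuousWithinAt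
    · intro s hs
      obtain ⟨d, hd, -⟩ := key s (interior_subset hs)
      exact hd.differentiableAt.differentiableWithinAt
    · intro s hs
      obtain ⟨d, hd, hd0⟩ := key s (interior_subset hs)
      rwa [hd.deriv]
  simpa [hγ, mobius_zero, hypExp_zero] using hmono (left_mem_Icc.mpr zero_le_one) ht ht.1

/-- Integrating the Bloch quantity along the hyperbolic geodesic from `a` to `φ_a(w)`. -/
lemma norm_sub_le_of_bloch_le {C K : ℝ} {ω : ℂ → ℝ} {f : ℂ → ℂ} (hC : 0 < C) (hK : 0 ≤ K)
    (hωpos : ∀ z ∈ unitDisc, 0 < ω z) (hω : DifferentiableOn ℝ ω unitDisc)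
    (hreg : ∀ z ∈ unitDisc, (1 - ‖z‖ ^ 2) * ‖fderivWithin ℝ ω unitDisc z‖ ≤ C * ω z)
    (hf : DifferentiableOn ℂ f unitDisc) (ha : ‖a‖ < 1) (hw : ‖w‖ < 1)
    (hbl : ∀ z ∈ unitDisc, ‖mobius a z‖ ≤ ‖w‖ → ‖deriv f z‖ * (1 - ‖z‖ ^ 2) * ω z ≤ K) :
    ‖f (mobius a w) - f a‖ ≤ K / (C * ω a) * hypExp C ‖w‖ := by
  have hωa := hωpos a (mem_unitDisc.mpr ha)
  set γ : ℝ → ℂ := fun s => mobius a (s * w) with hγ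
  have key : ∀ s ∈ Icc (0 : ℝ) 1, ∃ d : ℂ, HasDerivAt (fun s : ℝ => f (γ s) - f a) d s ∧
      ‖d‖ ≤ K / (C * ω a) * (hypExp C (s * ‖w‖) * (C / (1 - (s * ‖w‖) ^ 2)) * ‖w‖) := by
    intro s hs
    obtain ⟨v, hv, hvn⟩ := exists_hasDerivAt_mobius_path ha hw hs
    have hsw1 := norm_ofReal_mul_lt_one hw hs
    have hγs : ‖γ s‖ < 1 := norm_mobius_lt_one ha hsw1
    have hmem : γ s ∈ unitDisc := mem_unitDisc.mpr hγs
    have hfs : HasDerivAt f (deriv f (γ s)) (γ s) :=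
      (hf.differentiableAt (isOpen_unitDisc.mem_nhds hmem)).hasDerivAt
    refine ⟨_, (hfs.comp s hv).sub_const (f a), ?_⟩
    have hsw : 0 < 1 - (s * ‖w‖) ^ 2 := by
      have : s * ‖w‖ < 1 := by nlinarith [norm_nonneg w, hs.1, hs.2]
      nlinarith [mul_nonneg hs.1 (norm_nonneg w)]
    have hle : ‖mobius a (γ s)‖ ≤ ‖w‖ := by
      rw [hγ, mobius_mobius ha hsw1, norm_mul, Complex.norm_real, Real.norm_of_nonneg hs.1]
      nlinarith [norm_nonneg w, hs.2]
    have hb := hbl _ hmem hle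
    have hωs := hωpos _ hmem
    have hg := regular_weight_le hω hreg ha hw hs
    have hE := hypExp_pos C (s * ‖w‖)
    have hb0 : 0 ≤ ‖deriv f (γ s)‖ * (1 - ‖γ s‖ ^ 2) :=
      mul_nonneg (norm_nonneg _) (by nlinarith [norm_nonneg (γ s)])
    have h2 : ‖deriv f (γ s)‖ * (1 - ‖γ s‖ ^ 2) ≤ K / ω a * hypExp C (s * ‖w‖) := by
      rw [div_mul_eq_mul_div, le_div_iff₀ hωa]
      calc _ ≤ ‖deriv f (γ s)‖ * (1 - ‖γ s‖ ^ 2) * (ω (γ s) * hypExp C (s * ‖w‖)) := by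
            gcongr
        _ = ‖deriv f (γ s)‖ * (1 - ‖γ s‖ ^ 2) * ω (γ s) * hypExp C (s * ‖w‖) := by ring
        _ ≤ _ := by gcongr
    calc ‖deriv f (γ s) * v‖ =
          ‖deriv f (γ s)‖ * (1 - ‖γ s‖ ^ 2) * (‖w‖ / (1 - (s * ‖w‖) ^ 2)) := by
          rw [norm_mul, hvn]; ring
      _ ≤ K / ω a * hypExp C (s * ‖w‖) * (‖w‖ / (1 - (s * ‖w‖) ^ 2)) := by gcongr
      _ = _ := by field_simp
  choose! d hd hdn using key
  have hB : ∀ s ∈ Icc (0 : ℝ) 1, HasDerivAt (fun s : ℝ => K / (C * ω a) * hypExp C (s * ‖w‖))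
      (K / (C * ω a) * (hypExp C (s * ‖w‖) * (C / (1 - (s * ‖w‖) ^ 2)) * ‖w‖)) s :=
    fun s hs => (hasDerivAt_hypExp_mul C hw hs).const_mul _
  have := image_norm_le_of_norm_deriv_right_le_deriv_boundary'
    (f := fun s : ℝ => f (γ s) - f a) (f' := d) (a := 0) (b := 1)
    (fun s hs => (hd s hs).continuousAt.continuousWithinAt)
    (fun s hs => (hd s (Ico_subset_Icc_self hs)).hasDerivWithinAt)
    (B := fun s : ℝ => K / (C * ω a) * hypExp C (s * ‖w‖))
    (by simpa [hγ, mobius_zero] using mul_nonneg (by positivity) (hypExp_pos C 0).le)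
    (fun s hs => (hB s hs).continuousAt.continuousWithinAt)
    (fun s hs => (hB s (Ico_subset_Icc_self hs)).hasDerivWithinAt)
    (fun s hs => hdn s (Ico_subset_Icc_self hs)) (right_mem_Icc.mpr zero_le_one)
  simpa [hγ] using this

end Path

lemma abs_det_restrictScalars_toSpanSingleton (c : ℂ) :
    |((ContinuousLinearMap.toSpanSingleton ℂ c).restrictScalars ℝ).det| = ‖c‖ ^ 2 := by
  have : (((ContinuousLinearMap.toSpanSingleton ℂ c).restrictScalars ℝ : ℂ →L[ℝ] ℂ) : ℂ →ₗ[ℝ] ℂ)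
      = Algebra.lmul ℝ ℂ c := by
    ext
    simp [mul_comm]
  rw [ContinuousLinearMap.det, this]
  have h := Algebra.norm_complex_apply c
  rw [Algebra.norm_apply] at h
  rw [h, Complex.normSq_eq_norm_sq, abs_of_nonneg (by positivity)]

lemma lintegral_norm_deriv_sq_eq_volume_image {f : ℂ → ℂ} {s : Set ℂ} (hs : MeasurableSet s)
    (hf : ∀ z ∈ s, DifferentiableAt ℂ f z) (hinj : InjOn f s) :
    ∫⁻ z in s, ENNReal.ofReal (‖deriv f z‖ ^ 2) = volume (f '' s) := by
  rw [← lintegral_abs_det_fderiv_eq_addHaar_image volume hs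
    (f' := fun z => (ContinuousLinearMap.toSpanSingleton ℂ (deriv f z)).restrictScalars ℝ)
    (fun z hz => ((hf z hz).hasDerivAt.hasFDerivAt.restrictScalars ℝ).hasFDerivWithinAt) hinj]
  simp only [abs_det_restrictScalars_toSpanSingleton]

lemma measurable_mobius (a : ℂ) : Measurable (mobius a) := by
  unfold mobius
  fun_prop

/-- Area of the image of a pseudohyperbolic disc. -/
lemma lintegral_pseudohyperbolic_disc_le {a : ℂ} {C K t : ℝ} {ω : ℂ → ℝ} {f : ℂ → ℂ}
    (hC0 : 0 < C) (hC1 : C < 1) (hK : 0 ≤ K)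
    (hωpos : ∀ z ∈ unitDisc, 0 < ω z) (hω : DifferentiableOn ℝ ω unitDisc)
    (hreg : ∀ z ∈ unitDisc, (1 - ‖z‖ ^ 2) * ‖fderivWithin ℝ ω unitDisc z‖ ≤ C * ω z)
    (hf : DifferentiableOn ℂ f unitDisc) (hinj : InjOn f unitDisc) (ha : ‖a‖ < 1)
    (ht : 0 < t)
    (hbl : ∀ z ∈ unitDisc, ‖mobius a z‖ ^ 2 < 1 - t →
      ‖deriv f z‖ * (1 - ‖z‖ ^ 2) * ω z ≤ K) :
    ∫⁻ z in {z | t < 1 - ‖mobius a z‖ ^ 2} ∩ unitDisc, ENNReal.ofReal (‖deriv f z‖ ^ 2) ≤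
      ENNReal.ofReal (4 * Real.pi / (C * ω a) ^ 2 * K ^ 2 * t ^ (-C)) := by
  have hωa := hωpos a (mem_unitDisc.mpr ha)
  have hmeas : MeasurableSet ({z | t < 1 - ‖mobius a z‖ ^ 2} ∩ unitDisc) := by
    have := measurable_mobius a
    exact (measurableSet_lt (by fun_prop) (by fun_prop)).inter isOpen_unitDisc.measurableSet
  rw [lintegral_norm_deriv_sq_eq_volume_image hmeas
    (fun z hz => hf.differentiableAt (isOpen_unitDisc.mem_nhds hz.2))
    (hinj.mono inter_subset_right)]
  set R := K / (C * ω a) * (2 * t ^ (-C / 2)) with hR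
  have hsub : f '' ({z | t < 1 - ‖mobius a z‖ ^ 2} ∩ unitDisc) ⊆ Metric.closedBall (f a) R := by
    rintro _ ⟨z, ⟨hz, hzD⟩, rfl⟩
    have hz1 := mem_unitDisc.mp hzD
    have hw := norm_mobius_lt_one ha hz1
    have hz : t < 1 - ‖mobius a z‖ ^ 2 := hz
    have h1 := norm_sub_le_of_bloch_le hC0 hK hωpos hω hreg hf ha hw (fun z' hz' hle =>
      hbl z' hz' (by nlinarith [norm_nonneg (mobius a z'), norm_nonneg (mobius a z)]))
    rw [mobius_mobius ha hz1] at h1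
    rw [Metric.mem_closedBall, dist_eq_norm]
    refine h1.trans ?_
    rw [hR]
    gcongr
    exact hypExp_le hC0 hC1 (norm_nonneg _) ht (by linarith)
  refine (measure_mono hsub).trans (le_of_eq ?_)
  have ht2 : t ^ (-C) = (t ^ (-C / 2)) ^ 2 := by
    rw [← Real.rpow_natCast, ← Real.rpow_mul ht.le]; congr 1; push_cast; ring
  rw [Complex.volume_closedBall, ← ENNReal.ofReal_pow (by positivity), ← NNReal.coe_real_pi,
    ← ENNReal.ofReal_coe_nnreal, ← ENNReal.ofReal_mul (by positivity), hR, ht2]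
  congr 1
  ring

lemma lintegral_Ioc_rpow_neg {C x : ℝ} (hC1 : C < 1) (hx : 0 ≤ x) :
    ∫⁻ t in Ioc 0 x, ENNReal.ofReal (t ^ (-C)) = ENNReal.ofReal (x ^ (1 - C) / (1 - C)) := by
  have hint : IntervalIntegrable (fun t : ℝ => t ^ (-C)) volume 0 x :=
    intervalIntegral.intervalIntegrable_rpow' (by linarith)
  rw [← ofReal_integral_eq_lintegral_ofReal ((intervalIntegrable_iff_integrableOn_Ioc_of_le hx).mp
    hint), ← intervalIntegral.integral_of_le hx, integral_rpow (Or.inl (by linarith))]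
  · rw [Real.zero_rpow (by linarith), sub_zero, neg_add_eq_sub]
  · filter_upwards [ae_restrict_mem measurableSet_Ioc] with t ht
    exact Real.rpow_nonneg ht.1.le _

/-- Quantitative estimate: `K` bounds the weighted Bloch quantity everywhere, and `η` bounds it
on the pseudohyperbolic disc of radius `√(1 - δ)` about `a`. -/
lemma sq_mul_bmoaSemi_le {a : ℂ} {C K η δ : ℝ} {ω : ℂ → ℝ} {f : ℂ → ℂ}
    (hC0 : 0 < C) (hC1 : C < 1) (hK : 0 ≤ K) (hη : 0 ≤ η) (hδ : 0 < δ)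
    (hωpos : ∀ z ∈ unitDisc, 0 < ω z) (hω : DifferentiableOn ℝ ω unitDisc)
    (hreg : ∀ z ∈ unitDisc, (1 - ‖z‖ ^ 2) * ‖fderivWithin ℝ ω unitDisc z‖ ≤ C * ω z)
    (hf : DifferentiableOn ℂ f unitDisc) (hinj : InjOn f unitDisc) (ha : ‖a‖ < 1)
    (hblK : ∀ z ∈ unitDisc, ‖deriv f z‖ * (1 - ‖z‖ ^ 2) * ω z ≤ K)
    (hblη : ∀ z ∈ unitDisc, ‖mobius a z‖ ^ 2 < 1 - δ →
      ‖deriv f z‖ * (1 - ‖z‖ ^ 2) * ω z ≤ η) :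
    (ω a) ^ 2 * bmoaSemi f a ≤ 4 / (C ^ 2 * (1 - C)) * (η ^ 2 + K ^ 2 * δ ^ (1 - C)) := by
  have hωa := hωpos a (mem_unitDisc.mpr ha)
  have hCC : 0 < 1 - C := by linarith
  have hmob := measurable_mobius a
  set A := 4 * Real.pi / (C * ω a) ^ 2 with hA
  have hA0 : 0 < A := by have := Real.pi_pos; positivity
  set μ : Measure ℂ :=
    (volume.restrict unitDisc).withDensity (fun z => ENNReal.ofReal (‖deriv f z‖ ^ 2)) with hμ
  have hdens : Measurable (fun z => ENNReal.ofReal (‖deriv f z‖ ^ 2)) := by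
    have := measurable_deriv f
    fun_prop
  have hnn : ∀ z ∈ unitDisc, 0 ≤ 1 - ‖mobius a z‖ ^ 2 := fun z hz => by
    have := norm_mobius_lt_one ha (mem_unitDisc.mp hz)
    nlinarith [norm_nonneg (mobius a z)]
  have hlevel : ∀ t : ℝ, μ {z | t < 1 - ‖mobius a z‖ ^ 2} =
      ∫⁻ z in {z | t < 1 - ‖mobius a z‖ ^ 2} ∩ unitDisc, ENNReal.ofReal (‖deriv f z‖ ^ 2) := by
    intro t
    have hmeas : MeasurableSet {z | t < 1 - ‖mobius a z‖ ^ 2} :=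
      measurableSet_lt (by fun_prop) (by fun_prop)
    rw [hμ, withDensity_apply _ hmeas, Measure.restrict_restrict hmeas]
  have hbound : ∀ t ∈ Ioi (0 : ℝ), μ {z | t < 1 - ‖mobius a z‖ ^ 2} ≤
      (Ioc 0 1).indicator (fun t => ENNReal.ofReal (A * η ^ 2) * ENNReal.ofReal (t ^ (-C))) t +
      (Ioc 0 δ).indicator (fun t => ENNReal.ofReal (A * K ^ 2) * ENNReal.ofReal (t ^ (-C))) t := by
    intro t ht
    rw [hlevel]
    rcases le_or_gt t δ with htδ | htδ
    · rw [indicator_of_mem (show t ∈ Ioc 0 δ from ⟨ht, htδ⟩), ← ENNReal.ofReal_mul (by positivity)]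
      exact le_add_left (lintegral_pseudohyperbolic_disc_le hC0 hC1 hK hωpos hω hreg hf hinj ha ht
        fun z hz _ => hblK z hz)
    · refine le_add_right ?_
      rcases le_or_gt t 1 with ht1 | ht1
      · rw [indicator_of_mem (show t ∈ Ioc (0 : ℝ) 1 from ⟨ht, ht1⟩),
          ← ENNReal.ofReal_mul (by positivity)]
        exact lintegral_pseudohyperbolic_disc_le hC0 hC1 hη hωpos hω hreg hf hinj ha ht
          fun z hz h => hblη z hz (by linarith)
      · have : {z | t < 1 - ‖mobius a z‖ ^ 2} = ∅ :=
          eq_empty_of_forall_notMem fun z (hz : t < 1 - ‖mobius a z‖ ^ 2) => by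
            nlinarith [sq_nonneg ‖mobius a z‖]
        simp [this]
  have hrp : Measurable fun t : ℝ => ENNReal.ofReal (t ^ (-C)) := by fun_prop
  have hlint : ∫⁻ z in unitDisc, ENNReal.ofReal (‖deriv f z‖ ^ 2 * (1 - ‖mobius a z‖ ^ 2)) ≤
      ENNReal.ofReal (A * η ^ 2 * (1 / (1 - C)) + A * K ^ 2 * (δ ^ (1 - C) / (1 - C))) := by
    calc ∫⁻ z in unitDisc, ENNReal.ofReal (‖deriv f z‖ ^ 2 * (1 - ‖mobius a z‖ ^ 2))
        = ∫⁻ z, ENNReal.ofReal (1 - ‖mobius a z‖ ^ 2) ∂μ := by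
          rw [hμ, lintegral_withDensity_eq_lintegral_mul _ hdens (by fun_prop)]
          refine lintegral_congr fun z => ?_
          rw [ENNReal.ofReal_mul (by positivity)]
          rfl
      _ = ∫⁻ t in Ioi (0 : ℝ), μ {z | t < 1 - ‖mobius a z‖ ^ 2} := by
          refine lintegral_eq_lintegral_meas_lt μ ?_ (by fun_prop)
          refine (withDensity_absolutelyContinuous _ _).ae_le ?_
          filter_upwards [ae_restrict_mem isOpen_unitDisc.measurableSet] with z hz
          exact hnn z hz
      _ ≤ ∫⁻ t in Ioi (0 : ℝ), ((Ioc 0 1).indicator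
            (fun t => ENNReal.ofReal (A * η ^ 2) * ENNReal.ofReal (t ^ (-C))) t +
          (Ioc 0 δ).indicator
            (fun t => ENNReal.ofReal (A * K ^ 2) * ENNReal.ofReal (t ^ (-C))) t) :=
          setLIntegral_mono' measurableSet_Ioi hbound
      _ ≤ ∫⁻ t : ℝ, ((Ioc 0 1).indicator
            (fun t => ENNReal.ofReal (A * η ^ 2) * ENNReal.ofReal (t ^ (-C))) t +
          (Ioc 0 δ).indicator
            (fun t => ENNReal.ofReal (A * K ^ 2) * ENNReal.ofReal (t ^ (-C))) t) :=
          setLIntegral_le_lintegral _ _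
      _ = _ := by
          rw [lintegral_add_left ((hrp.const_mul _).indicator measurableSet_Ioc),
            lintegral_indicator measurableSet_Ioc, lintegral_indicator measurableSet_Ioc,
            lintegral_const_mul _ hrp, lintegral_const_mul _ hrp,
            lintegral_Ioc_rpow_neg hC1 zero_le_one, lintegral_Ioc_rpow_neg hC1 hδ.le,
            Real.one_rpow, ENNReal.ofReal_add (by positivity) (by positivity),
            ENNReal.ofReal_mul (p := A * η ^ 2) (by positivity),
            ENNReal.ofReal_mul (p := A * K ^ 2) (by positivity)]
  have hint : ∫ z in unitDisc, ‖deriv f z‖ ^ 2 * (1 - ‖mobius a z‖ ^ 2) ≤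
      A * η ^ 2 * (1 / (1 - C)) + A * K ^ 2 * (δ ^ (1 - C) / (1 - C)) := by
    rw [integral_eq_lintegral_of_nonneg_ae]
    · exact ENNReal.toReal_le_of_le_ofReal (by positivity) hlint
    · filter_upwards [ae_restrict_mem isOpen_unitDisc.measurableSet] with z hz
      exact mul_nonneg (sq_nonneg _) (hnn z hz)
    · have := measurable_deriv f
      exact Measurable.aestronglyMeasurable (by fun_prop)
  have hpi := Real.pi_pos
  calc (ω a) ^ 2 * bmoaSemi f a ≤ (ω a) ^ 2 * ((Real.pi)⁻¹ *
        (A * η ^ 2 * (1 / (1 - C)) + A * K ^ 2 * (δ ^ (1 - C) / (1 - C)))) := by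
        rw [bmoaSemi]; gcongr
    _ = _ := by rw [hA]; field_simp

/-- Pseudohyperbolic discs of fixed radius are close to the boundary when their centre is. -/
lemma norm_gt_of_norm_mobius_sq_lt {a z : ℂ} {δ r : ℝ} (hδ : 0 < δ) (ha : ‖a‖ < 1) (hz : ‖z‖ < 1)
    (hza : ‖mobius a z‖ ^ 2 < 1 - δ) (har : 1 - δ ^ 2 * (1 - r ^ 2) / 8 < ‖a‖) : r < ‖z‖ := by
  set w := mobius a z with hw
  have hw1 : ‖w‖ < 1 := norm_mobius_lt_one ha hz
  have hb : δ / 2 ≤ ‖1 - (starRingEnd ℂ) a * w‖ := by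
    have h1 := norm_sub_norm_le (1 : ℂ) ((starRingEnd ℂ) a * w)
    rw [norm_mul, RCLike.norm_conj, norm_one] at h1
    nlinarith [norm_nonneg a, norm_nonneg w]
  have h2 : 1 - ‖z‖ ^ 2 = (1 - ‖a‖ ^ 2) * (1 - ‖w‖ ^ 2) / ‖1 - (starRingEnd ℂ) a * w‖ ^ 2 := by
    rw [← one_sub_norm_mobius_sq ha hw1, hw, mobius_mobius ha hz]
  have ha2 : 0 < 1 - ‖a‖ ^ 2 := by nlinarith [norm_nonneg a]
  have h3 : 1 - ‖z‖ ^ 2 < 1 - r ^ 2 := by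
    have hb0 : 0 < ‖1 - (starRingEnd ℂ) a * w‖ := by linarith
    have hb2 : (δ / 2) ^ 2 ≤ ‖1 - (starRingEnd ℂ) a * w‖ ^ 2 := by gcongr
    have h4 : 1 - ‖a‖ ^ 2 < (δ / 2) ^ 2 * (1 - r ^ 2) := by nlinarith [norm_nonneg a]
    have h5 : 0 < 1 - r ^ 2 := by
      by_contra! h
      nlinarith [mul_nonneg (sq_nonneg (δ / 2)) (neg_nonneg.mpr h)]
    rw [h2, div_lt_iff₀ (by positivity)]
    nlinarith [sq_nonneg ‖w‖, mul_le_mul_of_nonneg_left hb2 h5.le]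
  nlinarith [norm_nonneg z]

/-- The weighted Bloch quantity is bounded when it vanishes at the boundary. -/
lemma exists_weighted_bloch_bound {ω : ℂ → ℝ} {f : ℂ → ℂ}
    (hω : ContinuousOn ω unitDisc) (hf : DifferentiableOn ℂ f unitDisc)
    (hvan : ∀ ε > 0, ∃ r < 1, ∀ z ∈ unitDisc, r < ‖z‖ →
      ‖deriv f z‖ * (1 - ‖z‖ ^ 2) * ω z < ε) :
    ∃ K ≥ 0, ∀ z ∈ unitDisc, ‖deriv f z‖ * (1 - ‖z‖ ^ 2) * ω z ≤ K := by
  obtain ⟨r, hr, h⟩ := hvan 1 one_pos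
  have hsub : Metric.closedBall (0 : ℂ) r ⊆ unitDisc := Metric.closedBall_subset_ball hr
  have hcont : ContinuousOn (fun z => ‖deriv f z‖ * (1 - ‖z‖ ^ 2) * ω z) unitDisc := by
    have := (hf.deriv isOpen_unitDisc).continuousOn
    fun_prop
  obtain ⟨M, hM⟩ := (isCompact_closedBall (0 : ℂ) r).bddAbove_image (hcont.mono hsub)
  refine ⟨max 1 M, by positivity, fun z hz => ?_⟩
  rcases le_or_gt ‖z‖ r with hzr | hzr
  · exact (hM ⟨z, by simpa using hzr, rfl⟩).trans (le_max_right _ _)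
  · exact (h z hz hzr).le.trans (le_max_left _ _)

/-- If `f` is univalent and `|f'(z)|(1-|z|²)ω(z) → 0` as `|z| → 1⁻` for a
regular weight `ω` with constant `C_ω < 1`, then
`ω(a)² ∫_𝔻 |f'(z)|²(1-|φ_a(z)|²) dm(z) → 0` as `|a| → 1⁻`. -/
theorem weighted_garsia_vanishes_of_univalent
    (Cw : ℝ) (hCpos : 0 < Cw) (hClt : Cw < 1)
    (ω : ℂ → ℝ) (hωpos : ∀ z ∈ unitDisc, 0 < ω z)
    (hωC1 : ContDiffOn ℝ 1 ω unitDisc)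
    (hreg : ∀ z ∈ unitDisc, (1 - ‖z‖ ^ 2) * ‖fderivWithin ℝ ω unitDisc z‖ ≤ Cw * ω z)
    (f : ℂ → ℂ) (hf : DifferentiableOn ℂ f unitDisc) (hinj : Set.InjOn f unitDisc)
    (hvan : ∀ ε > 0, ∃ r < 1, ∀ z ∈ unitDisc, r < ‖z‖ →
      ‖deriv f z‖ * (1 - ‖z‖ ^ 2) * ω z < ε) :
    ∀ ε > 0, ∃ r < 1, ∀ a ∈ unitDisc, r < ‖a‖ →
      (ω a) ^ 2 * bmoaSemi f a < ε := by
  intro ε hε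
  have hω := hωC1.differentiableOn one_ne_zero
  have hCC : 0 < 1 - Cw := by linarith
  obtain ⟨K, hK, hblK⟩ := exists_weighted_bloch_bound hωC1.continuousOn hf hvan
  set B := 4 / (Cw ^ 2 * (1 - Cw)) with hB
  have hB0 : 0 < B := by positivity
  obtain ⟨η, hη, hηε⟩ : ∃ η > 0, B * η ^ 2 < ε / 2 := by
    have h : Tendsto (fun x : ℝ => B * x ^ 2) (nhdsWithin 0 (Ioi 0)) (nhds 0) :=
      tendsto_nhdsWithin_of_tendsto_nhds (Continuous.tendsto' (by fun_prop) _ _ (by simp))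
    exact (eventually_mem_nhdsWithin.and (h.eventually_lt_const (half_pos hε))).exists
  obtain ⟨δ, hδ, hδε⟩ : ∃ δ > 0, B * (K ^ 2 * δ ^ (1 - Cw)) < ε / 2 := by
    have hc : Continuous fun x : ℝ => B * (K ^ 2 * x ^ (1 - Cw)) :=
      ((Real.continuous_rpow_const hCC.le).const_mul _).const_mul _
    have h : Tendsto (fun x : ℝ => B * (K ^ 2 * x ^ (1 - Cw))) (nhdsWithin 0 (Ioi 0)) (nhds 0) :=
      tendsto_nhdsWithin_of_tendsto_nhds
        (hc.tendsto' _ _ (by simp [Real.zero_rpow hCC.ne']))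
    exact (eventually_mem_nhdsWithin.and (h.eventually_lt_const (half_pos hε))).exists
  obtain ⟨r, hr, hblr⟩ := hvan η hη
  have hr0 : 0 ≤ max r 0 := le_max_right _ _
  have hr1 : max r 0 < 1 := max_lt hr one_pos
  refine ⟨1 - δ ^ 2 * (1 - (max r 0) ^ 2) / 8, ?_, fun a ha har => ?_⟩
  · have : 0 < 1 - (max r 0) ^ 2 := by nlinarith
    have : 0 < δ ^ 2 * (1 - (max r 0) ^ 2) / 8 := by positivity
    linarith
  have ha1 := mem_unitDisc.mp ha
  have := sq_mul_bmoaSemi_le hCpos hClt hK hη.le hδ hωpos hω hreg hf hinj ha1 hblK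
    (fun z hz hza => (hblr z hz ((le_max_left r 0).trans_lt
      (norm_gt_of_norm_mobius_sq_lt hδ ha1 (mem_unitDisc.mp hz) hza har))).le)
  rw [← hB, mul_add] at this
  linarith
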